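/- arXiv:1105.0142 — 2 statements merged into one kernel-verified Lean document; each statement's English description precedes it below -/
import Mathlib

section
/- Let D be an integral domain with quotient field K ≠ D of finite character, i.e., every nonzero element of D lies in only finitely many maximal ideals of D. Then Int(D_p) = Int(D)_p for every prime ideal p of D; consequently Int(S⁻¹D) = S⁻¹Int(D) for every multiplicative subset S of D with 0 ∉ S. -/
namespace IVP

open Polynomial

variable {F : Type} [Field F]

/-- Integer-valued polynomials on the set `E` with values in `D`:
`Int(E,D) = {f ∈ F[X] : f(E) ⊆ D}`. -/
def IntOn (E D : Set F) : Set (Polynomial F) := {f | ∀ x ∈ E, f.eval x ∈ D}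

/-- `Int(D) = {f ∈ F[X] : f(D) ⊆ D}`. -/
def IntR (D : Set F) : Set (Polynomial F) := IntOn D D

/-- Polynomials with all coefficients in `R`, i.e. `R[X]` as a subset of `F[X]`. -/
def polySet (R : Set F) : Set (Polynomial F) := {f | ∀ n, f.coeff n ∈ R}

/-- `I⁻¹ = (D :_K I) = {x : x·I ⊆ D}`. -/
def dinv (D I : Set F) : Set F := {x | ∀ y ∈ I, x * y ∈ D}

/-- `I_v = (I⁻¹)⁻¹`. -/
def dv (D I : Set F) : Set F := dinv D (dinv D I)

/-- `I_t = ⋃ J_v`, the union over all nonzero finitely generated fractional ideals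
`J ⊆ I`; such a `J` is the `D`-span of a finite set `T ⊆ I` containing a nonzero
element, and `J_v` depends only on `T`. -/
def dt (D I : Set F) : Set F :=
  {x | ∃ T : Finset F, ↑T ⊆ I ∧ (∃ y ∈ T, y ≠ 0) ∧ x ∈ dv D ↑T}

/-- The image in `F` of a set of elements of the subring `D`. -/
def iset (D : Subring F) (I : Set ↥D) : Set F := (↑) '' I

/-- `I` is a t-ideal: `I_t = I`. -/
def IsTIdeal (D I : Set F) : Prop := dt D I = I

/-- `I` is a v-ideal: `I_v = I`. -/
def IsVIdeal (D I : Set F) : Prop := dv D I = I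

/-- `p` is a t-maximal ideal of `D`: maximal among the t-ideals properly contained
in `D`. -/
def IsTMax (D : Subring F) (p : Ideal ↥D) : Prop :=
  p ≠ ⊤ ∧ IsTIdeal ↑D (iset D ↑p) ∧
    ∀ q : Ideal ↥D, q ≠ ⊤ → IsTIdeal ↑D (iset D ↑q) → p ≤ q → p = q

/-- `p` is a v-maximal ideal of `D`: maximal among the v-ideals properly contained
in `D`. -/
def IsVMax (D : Subring F) (p : Ideal ↥D) : Prop :=
  p ≠ ⊤ ∧ IsVIdeal ↑D (iset D ↑p) ∧
    ∀ q : Ideal ↥D, q ≠ ⊤ → IsVIdeal ↑D (iset D ↑q) → p ≤ q → p = q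

/-- The localization `S⁻¹D` of `D` at a multiplicative subset `S ⊆ D`, as a subset
of `F`. -/
def mlocSet (D : Subring F) (S : Set ↥D) : Set F :=
  {x | ∃ a : ↥D, ∃ s ∈ S, (s : F) * x = (a : F)}

/-- The localization `D_p` of `D` at the complement of `p`, as a subset of `F`. -/
def plocSet (D : Subring F) (p : Ideal ↥D) : Set F := mlocSet D {s | s ∉ p}

/-- The localization `S⁻¹R` of a set `R` of polynomials at a multiplicative subset
`S ⊆ D`, as a subset of `F[X]`. -/
def mlocPoly (D : Subring F) (S : Set ↥D) (R : Set (Polynomial F)) : Set (Polynomial F) :=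
  {f | ∃ g ∈ R, ∃ s ∈ S, C (s : F) * f = g}

/-- The localization `R_p` of a set `R` of polynomials at `D ∖ p`. -/
def plocPoly (D : Subring F) (p : Ideal ↥D) (R : Set (Polynomial F)) : Set (Polynomial F) :=
  mlocPoly D {s | s ∉ p} R

/-- The ideal `pD_p` of the localization `D_p`, as a subset of `F`. -/
def plocIdl (D : Subring F) (p : Ideal ↥D) : Set F :=
  {x | ∃ y ∈ p, ∃ s : ↥D, s ∉ p ∧ (s : F) * x = ((y : ↥D) : F)}

/-- `p` is t-localizing: `pD_p` is a t-ideal of `D_p`. -/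
def TLocalizing (D : Subring F) (p : Ideal ↥D) : Prop :=
  IsTIdeal (plocSet D p) (plocIdl D p)

/-- `F` is the quotient field of `D`. -/
def IsQuotField (D : Subring F) : Prop :=
  ∀ x : F, ∃ a b : ↥D, b ≠ 0 ∧ (b : F) * x = (a : F)

/-- The quotient field of `D`, as a subset of the ambient field. -/
def fracSet (D : Subring F) : Set F :=
  {x | ∃ a b : ↥D, b ≠ 0 ∧ (b : F) * x = (a : F)}

/-- The conductor ideal `(aD :_D bD) = {d ∈ D : d·b ∈ aD}` of `D`. -/
def Conductor (D : Subring F) (a b : ↥D) : Set ↥D := {d | ∃ c : ↥D, d * b = a * c}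

/-- Elementwise product of two subsets of `F`. -/
def setMul (A B : Set F) : Set F := {z | ∃ x ∈ A, ∃ y ∈ B, z = x * y}

/-- The ideal `I` of `D` is t-invertible: `(I⁻¹I)_t = D`. -/
def TInv (D : Subring F) (I : Ideal ↥D) : Prop :=
  dt ↑D (setMul (dinv ↑D (iset D ↑I)) (iset D ↑I)) = (↑D : Set F)

/-- The ideal `I` of `D` is v-invertible: `(I⁻¹I)_v = D`. -/
def VInv (D : Subring F) (I : Ideal ↥D) : Prop :=
  dv ↑D (setMul (dinv ↑D (iset D ↑I)) (iset D ↑I)) = (↑D : Set F)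

/-- `D` is a PVMD: every nonzero finitely generated ideal of `D` is t-invertible. -/
def IsPVMD (D : Subring F) : Prop :=
  ∀ I : Ideal ↥D, I ≠ ⊥ → I.FG → TInv D I

/-- `D` is an H domain: every v-invertible nonzero ideal of `D` is t-invertible. -/
def IsHDomain (D : Subring F) : Prop :=
  ∀ I : Ideal ↥D, I ≠ ⊥ → VInv D I → TInv D I

/-- `p ∈ sKr(K/D)`: `p` is a prime such that every finitely generated ideal
`I ⊆ p` satisfies `I ⊆ J ⊆ p` for some conductor ideal `J` of `D`. -/
def SKrMem (D : Subring F) (p : Ideal ↥D) : Prop :=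
  p.IsPrime ∧ ∀ I : Ideal ↥D, I.FG → I ≤ p →
    ∃ a b : ↥D, a ≠ 0 ∧ (↑I : Set ↥D) ⊆ Conductor D a b ∧ Conductor D a b ⊆ ↑p

/-- The localization `A_p` of `A ⊇ D` at the complement in `D` of a prime `p` of `D`,
as a subset of the ambient field. -/
def mixedLocSet (D A : Subring F) (p : Ideal ↥D) : Set F :=
  {x | ∃ a : ↥A, ∃ s : ↥D, s ∉ p ∧ (s : F) * x = (a : F)}

/-- `pD_p` is a principal ideal of `D_p`. -/
def PLocPrincipal (D : Subring F) (p : Ideal ↥D) : Prop :=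
  ∃ g : F, plocIdl D p = {x | ∃ d ∈ plocSet D p, x = d * g}

/-- The localization `A_p` of `A ⊇ D` at a prime `p` of `D`, as a subring of the
ambient field. -/
def mixedLoc (D A : Subring F) (hDA : D ≤ A) (p : Ideal ↥D) (hp : p.IsPrime) :
    Subring F where
  carrier := mixedLocSet D A p
  one_mem' := ⟨1, 1, fun h => hp.ne_top (Ideal.eq_top_of_isUnit_mem p h isUnit_one), by simp⟩
  zero_mem' := ⟨0, 1, fun h => hp.ne_top (Ideal.eq_top_of_isUnit_mem p h isUnit_one), by simp⟩
  mul_mem' := by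
    rintro x y ⟨a, s, hs, hx⟩ ⟨b, t, ht, hy⟩
    refine ⟨a * b, s * t, fun h => ((hp.mem_or_mem h).elim hs ht), ?_⟩
    push_cast
    rw [mul_mul_mul_comm, hx, hy]
  add_mem' := by
    rintro x y ⟨a, s, hs, hx⟩ ⟨b, t, ht, hy⟩
    refine ⟨⟨t, hDA t.2⟩ * a + ⟨s, hDA s.2⟩ * b, s * t,
      fun h => ((hp.mem_or_mem h).elim hs ht), ?_⟩
    push_cast
    rw [mul_add]
    rw [show ((s:F) * t) * x = (t:F) * ((s:F) * x) by ring, hx,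
      show ((s:F) * t) * y = (s:F) * ((t:F) * y) by ring, hy]
  neg_mem' := by
    rintro x ⟨a, s, hs, hx⟩
    exact ⟨-a, s, hs, by push_cast; rw [mul_neg, hx]⟩

/-- The localization `D_p` of `D` at a prime `p`, as a subring of `F`. -/
def primeLoc (D : Subring F) (p : Ideal ↥D) (hp : p.IsPrime) : Subring F :=
  mixedLoc D D le_rfl p hp

/-- `Int(D)` as a subring of `F[X]`. -/
def IntSubring (D : Subring F) : Subring (Polynomial F) where
  carrier := IntR ↑D
  one_mem' := fun x _ => by simpa using D.one_mem
  zero_mem' := fun x _ => by simpa using D.zero_mem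
  mul_mem' := fun hf hg x hx => by
    rw [eval_mul]; exact D.mul_mem (hf x hx) (hg x hx)
  add_mem' := fun hf hg x hx => by
    rw [eval_add]; exact D.add_mem (hf x hx) (hg x hx)
  neg_mem' := fun hf x hx => by
    rw [eval_neg]; exact D.neg_mem (hf x hx)

/-- `Int(D)` as a `D`-submodule of `F[X]`. -/
def intSubmodule (D : Subring F) : Submodule ↥D (Polynomial F) where
  carrier := IntR ↑D
  zero_mem' := fun x _ => by simpa using D.zero_mem
  add_mem' := fun hf hg x hx => by
    rw [eval_add]; exact D.add_mem (hf x hx) (hg x hx)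
  smul_mem' := fun c f hf x hx => by
    have h : c • f = C (c : F) * f := by
      rw [Algebra.smul_def]; rfl
    rw [h, eval_mul, eval_C]
    exact D.mul_mem c.2 (hf x hx)

/-- An overring `D'` of `D` as a `D`-submodule of `F`. -/
def subringSubmodule (D D' : Subring F) (h : D ≤ D') : Submodule ↥D F where
  carrier := ↑D'
  zero_mem' := D'.zero_mem
  add_mem' := fun ha hb => D'.add_mem ha hb
  smul_mem' := fun c x hx => by
    rw [Subring.smul_def]
    exact D'.mul_mem (h c.2) hx

/-- `Int(D)_p` as a `D_p`-submodule of `F[X]`. -/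
def plocIntSubmodule (D : Subring F) (p : Ideal ↥D) (hp : p.IsPrime) :
    Submodule ↥(primeLoc D p hp) (Polynomial F) where
  carrier := plocPoly D p (IntR ↑D)
  zero_mem' :=
    ⟨0, fun x _ => by simpa using D.zero_mem, 1,
      fun h => hp.ne_top (Ideal.eq_top_of_isUnit_mem p h isUnit_one), by simp⟩
  add_mem' := by
    rintro f f' ⟨g, hg, s, hs, hfg⟩ ⟨g', hg', t, ht, hfg'⟩
    refine ⟨C (t : F) * g + C (s : F) * g', ?_, s * t,
      fun h => ((hp.mem_or_mem h).elim hs ht), ?_⟩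
    · intro x hx
      rw [eval_add, eval_mul, eval_mul, eval_C, eval_C]
      exact D.add_mem (D.mul_mem t.2 (hg x hx)) (D.mul_mem s.2 (hg' x hx))
    · rw [← hfg, ← hfg']
      push_cast
      rw [map_mul]
      ring
  smul_mem' := by
    rintro c f ⟨g, hg, t, ht, hfg⟩
    obtain ⟨a, s, hs, hsc⟩ := c.2
    have h : c • f = C (c : F) * f := by rw [Algebra.smul_def]; rfl
    refine ⟨C (a : F) * g, ?_, s * t,
      fun hmem => ((hp.mem_or_mem hmem).elim hs ht), ?_⟩
    · intro x hx
      rw [eval_mul, eval_C]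
      exact D.mul_mem a.2 (hg x hx)
    · rw [h, ← hfg, ← hsc]
      push_cast
      rw [map_mul, map_mul]
      ring

section Extensions

variable {L : Type} [Field L]

/-- The data of an extension: the subring `A` of `L` contains the image of `D`
under the embedding `φ` of quotient fields. -/
def ExtMem (D : Subring F) (φ : F →+* L) (A : Subring L) : Prop := ∀ d : ↥D, φ d ∈ A

/-- The injective ring homomorphism `D → A` induced by `φ`. -/
noncomputable def extHom (D : Subring F) (φ : F →+* L) (A : Subring L)
    (h : ExtMem D φ A) : ↥D →+* ↥A :=
  (φ.comp D.subtype).codRestrict A.toSubsemiring (fun d => h d)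

/-- The extension `A ⊇ D` is polynomially regular: `Int(D,A) = A·Int(D)`. -/
def PolyReg (D : Subring F) (φ : F →+* L) (A : Subring L) : Prop :=
  IntOn (φ '' ↑D) ↑A = ↑(Submodule.span ↥A (Polynomial.map φ '' IntR (↑D : Set F)))

/-- The extension `A ⊇ D` is weakly polynomially complete: `Int(D) ⊆ Int(A)`. -/
def WPolyComplete (D : Subring F) (φ : F →+* L) (A : Subring L) : Prop :=
  Polynomial.map φ '' IntR (↑D : Set F) ⊆ IntR (↑A : Set L)

/-- The extension `A ⊇ D` is polynomially complete: `Int(D,A) = Int(A)`. -/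
def PolyComplete (D : Subring F) (φ : F →+* L) (A : Subring L) : Prop :=
  IntOn (φ '' ↑D) ↑A = IntR (↑A : Set L)

/-- The extension `A ⊇ D` is flat: `A` is flat as a `D`-module. -/
def ExtFlat (D : Subring F) (φ : F →+* L) (A : Subring L) (h : ExtMem D φ A) : Prop :=
  letI : Module ↥D ↥A := Module.compHom ↥A (extHom D φ A h)
  Module.Flat ↥D ↥A

/-- The extension `A ⊇ D` is t-linked: `I_t = D` implies `(IA)_t = A` for every
nonzero ideal `I` of `D`. -/
def TLinkedExt (D : Subring F) (φ : F →+* L) (A : Subring L) (h : ExtMem D φ A) : Prop :=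
  ∀ I : Ideal ↥D, I ≠ ⊥ → dt ↑D (iset D ↑I) = (↑D : Set F) →
    dt ↑A (iset A ↑(Ideal.map (extHom D φ A h) I)) = (↑A : Set L)

/-- `D` is absolutely polynomially regular: every extension of `D` is polynomially
regular. -/
def AbsPolyReg (D : Subring F) : Prop :=
  ∀ (L : Type) [Field L], ∀ (φ : F →+* L) (A : Subring L),
    ExtMem D φ A → IsQuotField A → PolyReg D φ A

/-- `D` is polynomially F-regular: every flat extension of `D` is polynomially
regular. -/
def PFReg (D : Subring F) : Prop :=
  ∀ (L : Type) [Field L], ∀ (φ : F →+* L) (A : Subring L) (h : ExtMem D φ A),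
    IsQuotField A → ExtFlat D φ A h → PolyReg D φ A

/-- `D` is polynomially t-regular: every t-linked extension of `D` is polynomially
regular. -/
def PTReg (D : Subring F) : Prop :=
  ∀ (L : Type) [Field L], ∀ (φ : F →+* L) (A : Subring L) (h : ExtMem D φ A),
    IsQuotField A → TLinkedExt D φ A h → PolyReg D φ A

/-- `D` is polynomially L-regular: `Int(S⁻¹D) = S⁻¹Int(D)` for every multiplicative
subset `S` of `D` with `0 ∉ S`. -/
def PLReg (D : Subring F) : Prop :=
  ∀ S : Submonoid ↥D, (0 : ↥D) ∉ S →
    IntR (mlocSet D ↑S) = mlocPoly D ↑S (IntR (↑D : Set F))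

end Extensions

/-- The extension of an ideal `I` of `R` to an overring `S` of `R` inside a common
field: the ideal `IS` of `S` generated by `I`. -/
def extIdeal (R S : Subring F) (I : Ideal ↥R) : Ideal ↥S :=
  Ideal.span {y : ↥S | (y : F) ∈ iset R ↑I}

/-- Within a common field: `S` is a t-linked extension of `R`. -/
def TLinkedSub (R S : Subring F) : Prop :=
  R ≤ S ∧ ∀ I : Ideal ↥R, I ≠ ⊥ → dt ↑R (iset R ↑I) = (↑R : Set F) →
    dt ↑S (iset S ↑(extIdeal R S I)) = (↑S : Set F)

/-- Localization of a subset `R` of the ambient field at `D ∖ q`. -/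
def locOfSet (D : Subring F) (R : Set F) (q : Ideal ↥D) : Set F :=
  {x | ∃ y ∈ R, ∃ s : ↥D, s ∉ q ∧ (s : F) * x = y}

end IVP

namespace IVP

open Polynomial

variable {F : Type} [Field F]

/-- The localization `S⁻¹D` as a subring of `F`. -/
def mlocSubring (D : Subring F) (S : Submonoid ↥D) : Subring F where
  carrier := mlocSet D ↑S
  one_mem' := ⟨1, 1, S.one_mem, by simp⟩
  zero_mem' := ⟨0, 1, S.one_mem, by simp⟩
  mul_mem' := by
    rintro x y ⟨a, s, hs, hx⟩ ⟨b, t, ht, hy⟩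
    refine ⟨a * b, s * t, S.mul_mem hs ht, ?_⟩
    push_cast
    rw [mul_mul_mul_comm, hx, hy]
  add_mem' := by
    rintro x y ⟨a, s, hs, hx⟩ ⟨b, t, ht, hy⟩
    refine ⟨t * a + s * b, s * t, S.mul_mem hs ht, ?_⟩
    push_cast
    rw [← hx, ← hy]
    ring
  neg_mem' := by
    rintro x ⟨a, s, hs, hx⟩
    exact ⟨-a, s, hs, by push_cast; rw [mul_neg, hx]⟩

lemma mem_mlocSubring {D : Subring F} {S : Submonoid ↥D} {x : F} :
    x ∈ mlocSubring D S ↔ ∃ s ∈ S, (s : F) * x ∈ D :=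
  ⟨fun ⟨a, s, hs, h⟩ => ⟨s, hs, h ▸ a.2⟩, fun ⟨s, hs, h⟩ => ⟨⟨_, h⟩, s, hs, rfl⟩⟩

lemma le_mlocSubring (D : Subring F) (S : Submonoid ↥D) : D ≤ mlocSubring D S :=
  fun x hx => mem_mlocSubring.2 ⟨1, S.one_mem, by simpa using hx⟩

lemma mem_mlocSubring_of_mul_mem {D : Subring F} {S : Submonoid ↥D} {s : ↥D} (hs : s ∈ S)
    {x : F} (h : (s : F) * x ∈ mlocSubring D S) : x ∈ mlocSubring D S := by
  obtain ⟨t, ht, h⟩ := mem_mlocSubring.1 h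
  exact mem_mlocSubring.2 ⟨t * s, S.mul_mem ht hs, by push_cast; rwa [mul_assoc]⟩

lemma exists_common_denom {D : Subring F} {S : Submonoid ↥D} {ι : Type*} (A : Finset ι)
    (x : ι → F) (h : ∀ i ∈ A, x i ∈ mlocSubring D S) :
    ∃ s ∈ S, ∀ i ∈ A, (s : F) * x i ∈ D := by
  classical
  have h' : ∀ i, ∃ s ∈ S, i ∈ A → (s : F) * x i ∈ D := fun i => by
    by_cases hi : i ∈ A
    · obtain ⟨s, hs, hsx⟩ := mem_mlocSubring.1 (h i hi)
      exact ⟨s, hs, fun _ => hsx⟩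
    · exact ⟨1, S.one_mem, fun h => absurd h hi⟩
  choose s hs hsx using h'
  refine ⟨∏ i ∈ A, s i, S.prod_mem fun i _ => hs i, fun i hi => ?_⟩
  rw [← Finset.prod_erase_mul A s hi]
  push_cast
  rw [mul_assoc]
  exact D.mul_mem (D.prod_mem fun j _ => (s j).2) (hsx i hi)

lemma exists_common_denom_coeff {D : Subring F} {S : Submonoid ↥D} (f : F[X])
    (h : ∀ n, f.coeff n ∈ mlocSubring D S) : ∃ s ∈ S, ∀ n, (s : F) * f.coeff n ∈ D := by
  obtain ⟨s, hs, hsf⟩ := exists_common_denom f.support f.coeff fun n _ => h n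
  refine ⟨s, hs, fun n => ?_⟩
  by_cases hn : n ∈ f.support
  · exact hsf n hn
  · rw [notMem_support_iff.1 hn, mul_zero]
    exact D.zero_mem

lemma eval_mem_of_coeff_mem {R : Subring F} {f : F[X]} (h : ∀ n, f.coeff n ∈ R) {x : F}
    (hx : x ∈ R) : f.eval x ∈ R := by
  rw [eval_eq_sum]
  exact R.sum_mem fun n _ => R.mul_mem (h n) (R.pow_mem hx n)

/-- A polynomial mapping `D` into `S⁻¹D` maps `S⁻¹D` into `S⁻¹D`. -/
lemma eval_mem_mlocSubring {D : Subring F} {S : Submonoid ↥D} (f : F[X])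
    (h : ∀ x ∈ D, f.eval x ∈ mlocSubring D S) {x : F} (hx : x ∈ mlocSubring D S) :
    f.eval x ∈ mlocSubring D S := by
  suffices H : ∀ n, ∀ f : F[X], f.degree < (n : ℕ) → (∀ x ∈ D, f.eval x ∈ mlocSubring D S) →
      ∀ x ∈ mlocSubring D S, f.eval x ∈ mlocSubring D S from
    H (f.natDegree + 1) f
      (lt_of_le_of_lt f.degree_le_natDegree (by exact_mod_cast Nat.lt_succ_self _)) h x hx
  intro n
  induction n with
  | zero =>
    intro f hf _ x _
    have : f = 0 := by
      rw [← degree_eq_bot]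
      simpa using hf
    rw [this, eval_zero]
    exact Subring.zero_mem _
  | succ n ih =>
    intro f hf h x hx
    obtain ⟨s, hs, hsx⟩ := mem_mlocSubring.1 hx
    have hsD (k : ℕ) : ((s : F) ^ k) ∈ mlocSubring D S :=
      le_mlocSubring D S (D.pow_mem s.2 k)
    set g : F[X] := C ((s : F) ^ n) * f - f.comp (C (s : F) * X) with hg
    have hgdeg : g.degree < (n : ℕ) := by
      rw [degree_lt_iff_coeff_zero]
      intro m hm
      rw [hg, coeff_sub, coeff_C_mul, comp_C_mul_X_coeff]
      rcases hm.eq_or_lt with rfl | hm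
      · ring
      · rw [(degree_lt_iff_coeff_zero f (n + 1)).1 hf m hm]
        ring
    have hgeval (y : F) : g.eval y = (s : F) ^ n * f.eval y - f.eval ((s : F) * y) := by
      simp [hg]
    have h1 := ih g hgdeg (fun y hy => by
      rw [hgeval]
      exact Subring.sub_mem _ (Subring.mul_mem _ (hsD n) (h y hy)) (h _ (D.mul_mem s.2 hy))) x hx
    rw [hgeval] at h1
    have h2 := Subring.add_mem _ h1 (h _ hsx)
    rw [sub_add_cancel] at h2
    exact mem_mlocSubring_of_mul_mem (s := s ^ n) (S.pow_mem hs n) (by push_cast; exact h2)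

/-- If `D/q` is infinite, a polynomial mapping `D` into `D_q` has coefficients in `D_q`. -/
lemma coeff_mem_of_infinite_quotient {D : Subring F} (q : Ideal ↥D) [q.IsPrime]
    [Infinite (↥D ⧸ q)] (f : F[X])
    (h : ∀ x ∈ D, f.eval x ∈ mlocSubring D q.primeCompl) (n : ℕ) :
    f.coeff n ∈ mlocSubring D q.primeCompl := by
  classical
  set R := mlocSubring D q.primeCompl
  obtain ⟨A, hA⟩ := Infinite.exists_subset_card_eq (↥D ⧸ q) (f.natDegree + 1)
  let v : ↥D ⧸ q → F := fun i => (i.out : F)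
  have hsub (i j : ↥D ⧸ q) (hij : i ≠ j) : i.out - j.out ∉ q := fun hmem => hij <| by
    rw [← Ideal.Quotient.eq] at hmem
    rwa [Ideal.Quotient.mk_out, Ideal.Quotient.mk_out] at hmem
  have hv : Function.Injective v := fun i j hij => by
    by_contra hne
    refine hsub i j hne ?_
    rw [Subtype.ext hij, sub_self]
    exact q.zero_mem
  have hinv (i j : ↥D ⧸ q) (hij : i ≠ j) : (v i - v j)⁻¹ ∈ R := by
    refine mem_mlocSubring.2 ⟨i.out - j.out, hsub i j hij, ?_⟩
    push_cast
    rw [mul_inv_cancel₀ (sub_ne_zero.2 (hv.ne hij))]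
    exact D.one_mem
  let P : Subring F[X] := (mapRingHom R.subtype).range
  have hC (r : F) (hr : r ∈ R) : C r ∈ P := ⟨C ⟨r, hr⟩, by simp⟩
  have hX : (X : F[X]) ∈ P := ⟨X, by simp⟩
  have hf : f ∈ P := by
    rw [Lagrange.eq_interpolate (s := A) (v := v) (f := f) hv.injOn
      (by rw [hA]; exact lt_of_le_of_lt f.degree_le_natDegree
            (by exact_mod_cast Nat.lt_succ_self _)), Lagrange.interpolate_apply]
    refine P.sum_mem fun i _ => P.mul_mem (hC _ (h _ (Quotient.out i).2)) ?_
    refine P.prod_mem fun j hj => P.mul_mem (hC _ (hinv i j ?_)) (P.sub_mem hX (hC _ ?_))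
    · exact (Finset.ne_of_mem_erase hj).symm
    · exact le_mlocSubring D _ (Quotient.out j).2
  obtain ⟨g, rfl⟩ := hf
  simp [coeff_map]

/-- The ideal `{x ∈ D : xA ⊆ D}` of `D`. -/
def denomIdeal (D : Subring F) (A : Set F) : Ideal ↥D where
  carrier := {x | ∀ y ∈ A, (x : F) * y ∈ D}
  zero_mem' := fun y _ => by simp
  add_mem' := fun {a b} ha hb y hy => by
    push_cast
    rw [add_mul]
    exact D.add_mem (ha y hy) (hb y hy)
  smul_mem' := fun c x hx y hy => by
    rw [smul_eq_mul]
    push_cast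
    rw [mul_assoc]
    exact D.mul_mem c.2 (hx y hy)

lemma infinite_quotient_of_lt {R : Type*} [CommRing R] {q m : Ideal R} [q.IsPrime]
    (hm : m ≠ ⊤) (hqm : q < m) : Infinite (R ⧸ q) := by
  by_contra hfin
  rw [not_infinite_iff_finite] at hfin
  have hq : q.IsMaximal := Ideal.Quotient.maximal_of_isField q (Finite.isField_of_domain _)
  exact hqm.ne (hq.eq_of_le hm hqm.le)

/-- A polynomial mapping `D` into `S⁻¹D` can be multiplied by an element of `S` so that it
maps `D` into `D_m`. -/
lemma exists_mul_eval_mem {D : Subring F} {S : Submonoid ↥D} (f : F[X])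
    (h : ∀ x ∈ D, f.eval x ∈ mlocSubring D S) (m : Ideal ↥D) [m.IsPrime] :
    ∃ s ∈ S, ∀ x ∈ D, (s : F) * f.eval x ∈ mlocSubring D m.primeCompl := by
  by_cases hSm : ∃ s ∈ S, s ∈ m
  · obtain ⟨s₀, hs₀, hs₀m⟩ := hSm
    suffices H : ∃ x ∈ S ⊔ m.primeCompl, x ∈ denomIdeal D (Set.range f.coeff) by
      obtain ⟨x, hx, hxf⟩ := H
      obtain ⟨s, hs, t, ht, rfl⟩ := Submonoid.mem_sup.1 hx
      refine ⟨s, hs, fun x hx => mem_mlocSubring.2 ⟨t, ht, ?_⟩⟩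
      have := eval_mem_of_coeff_mem (R := D) (f := C ((s * t : ↥D) : F) * f)
        (fun n => by rw [coeff_C_mul]; exact hxf _ ⟨n, rfl⟩) hx
      rw [eval_mul, eval_C] at this
      push_cast at this
      rwa [← mul_assoc, mul_comm (t : F)]
    by_contra! hcon
    obtain ⟨q, hq, hle, hdisj⟩ := Ideal.exists_le_prime_disjoint
      (denomIdeal D (Set.range f.coeff)) (S ⊔ m.primeCompl)
      (Set.disjoint_left.2 fun x hx hx' => hcon x hx' hx)
    have hnot (x : ↥D) (hx : x ∈ S ⊔ m.primeCompl) : x ∉ q :=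
      fun hxq => Set.disjoint_left.1 hdisj hxq hx
    have hqm : q < m := by
      refine lt_of_le_of_ne (fun x hx => ?_) ?_
      · by_contra hxm
        exact hnot x (Submonoid.mem_sup_right hxm) hx
      · rintro rfl
        exact hnot s₀ (Submonoid.mem_sup_left hs₀) hs₀m
    have := infinite_quotient_of_lt (Ideal.IsPrime.ne_top ‹m.IsPrime›) hqm
    obtain ⟨u, hu, huf⟩ := exists_common_denom_coeff f
      (coeff_mem_of_infinite_quotient q f fun x hx => by
        obtain ⟨s, hs, hsx⟩ := mem_mlocSubring.1 (h x hx)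
        exact mem_mlocSubring.2 ⟨s, hnot s (Submonoid.mem_sup_left hs), hsx⟩)
    refine hu (hle ?_)
    rintro _ ⟨n, rfl⟩
    exact huf n
  · refine ⟨1, S.one_mem, fun x hx => ?_⟩
    obtain ⟨s, hs, hsx⟩ := mem_mlocSubring.1 (h x hx)
    exact mem_mlocSubring.2 ⟨s, fun hsm => hSm ⟨s, hs, hsm⟩, by simpa using hsx⟩

lemma mem_of_forall_maximal {D : Subring F} {y : F}
    (h : ∀ m : Ideal ↥D, m.IsMaximal → ∃ t : ↥D, t ∉ m ∧ (t : F) * y ∈ D) : y ∈ D := by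
  have htop : denomIdeal D {y} = ⊤ := by
    by_contra hne
    obtain ⟨m, hm, hle⟩ := Ideal.exists_le_maximal _ hne
    obtain ⟨t, htm, hty⟩ := h m hm
    exact htm (hle (by rintro _ rfl; exact hty))
  have h1 : (1 : ↥D) ∈ denomIdeal D {y} := htop ▸ Submodule.mem_top
  simpa using h1 y rfl

/-- For `D` of finite character, a polynomial mapping `D` into `S⁻¹D` lies in `S⁻¹Int(D)`. -/
lemma mem_mlocPoly_of_eval_mem {D : Subring F} (hqf : IsQuotField D)
    (hfin : ∀ x : ↥D, x ≠ 0 → {p : Ideal ↥D | p.IsMaximal ∧ x ∈ p}.Finite)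
    {S : Submonoid ↥D} (f : F[X]) (h : ∀ x ∈ D, f.eval x ∈ mlocSubring D S) :
    f ∈ mlocPoly D ↑S (IntR (↑D : Set F)) := by
  classical
  obtain ⟨d, hd, hdf⟩ := exists_common_denom_coeff (D := D) (S := nonZeroDivisors ↥D) f
    fun n => by
      obtain ⟨a, b, hb, hab⟩ := hqf (f.coeff n)
      exact mem_mlocSubring.2 ⟨b, mem_nonZeroDivisors_of_ne_zero hb, hab ▸ a.2⟩
  have hloc : ∀ m : Ideal ↥D, ∃ s ∈ S, m.IsMaximal →
      ∀ x ∈ D, ∃ t : ↥D, t ∉ m ∧ (t : F) * ((s : F) * f.eval x) ∈ D := fun m => by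
    by_cases hm : m.IsMaximal
    · have := hm.isPrime
      obtain ⟨s, hs, hsf⟩ := exists_mul_eval_mem f h m
      exact ⟨s, hs, fun _ x hx => mem_mlocSubring.1 (hsf x hx)⟩
    · exact ⟨1, S.one_mem, fun h => absurd h hm⟩
  choose s hs hsf using hloc
  set A := (hfin d (nonZeroDivisors.ne_zero hd)).toFinset with hA
  refine ⟨_, ?_, ∏ m ∈ A, s m, S.prod_mem fun m _ => hs m, rfl⟩
  intro x hx
  rw [eval_mul, eval_C]
  refine mem_of_forall_maximal fun m hm => ?_
  by_cases hdm : d ∈ m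
  · have hmA : m ∈ A := by rw [hA, Set.Finite.mem_toFinset]; exact ⟨hm, hdm⟩
    obtain ⟨t, htm, ht⟩ := hsf m hm x hx
    refine ⟨t, htm, ?_⟩
    rw [← Finset.prod_erase_mul A s hmA]
    have := D.mul_mem (∏ m ∈ A.erase m, s m).2 ht
    push_cast at this ⊢
    convert this using 1
    ring
  · refine ⟨d, hdm, ?_⟩
    have := eval_mem_of_coeff_mem (R := D) (f := C (d : F) * f)
        (fun n => by rw [coeff_C_mul]; exact hdf n) hx
    rw [eval_mul, eval_C] at this
    rw [mul_left_comm]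
    exact D.mul_mem (Subtype.coe_prop _) this

lemma IntR_mlocSet {D : Subring F} (hqf : IsQuotField D)
    (hfin : ∀ x : ↥D, x ≠ 0 → {p : Ideal ↥D | p.IsMaximal ∧ x ∈ p}.Finite)
    (S : Submonoid ↥D) :
    IntR (mlocSet D ↑S) = mlocPoly D ↑S (IntR (↑D : Set F)) := by
  refine Set.Subset.antisymm (fun f hf => ?_) ?_
  · exact mem_mlocPoly_of_eval_mem hqf hfin f fun x hx => hf x (le_mlocSubring D S hx)
  · rintro f ⟨g, hg, s, hs, hfg⟩ x hx
    refine eval_mem_mlocSubring (D := D) (S := S) f (fun y hy => ?_) hx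
    refine mem_mlocSubring.2 ⟨s, hs, ?_⟩
    have := hg y hy
    rwa [← hfg, eval_mul, eval_C] at this

end IVP

open IVP Polynomial

/-- If `D` has finite character then `Int(D_p) = Int(D)_p` for every
prime `p`, and consequently `Int(S⁻¹D) = S⁻¹Int(D)` for every multiplicative subset
`S` with `0 ∉ S`. -/
theorem stmt_2 (F : Type) [Field F] (D : Subring F)
    (hqf : IsQuotField D) (hne : (↑D : Set F) ≠ Set.univ)
    (hfin : ∀ x : ↥D, x ≠ 0 → {p : Ideal ↥D | p.IsMaximal ∧ x ∈ p}.Finite) :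
    (∀ p : Ideal ↥D, p.IsPrime →
        IntR (plocSet D p) = plocPoly D p (IntR (↑D : Set F))) ∧
      ∀ S : Submonoid ↥D, (0 : ↥D) ∉ S →
        IntR (mlocSet D ↑S) = mlocPoly D ↑S (IntR (↑D : Set F)) :=
  ⟨fun p _ => IntR_mlocSet hqf hfin p.primeCompl, fun S _ => IntR_mlocSet hqf hfin S⟩
end

section
/- Let D be an integral domain with quotient field K ≠ D. (i) Every t-invertible t-prime ideal of D is t-maximal and belongs to Ass(K/D), i.e., equals (aD :_D bD) for some a, b ∈ D with a ≠ 0. (ii) A t-maximal ideal p of D is t-invertible if and only if pD_p is a principal ideal of D_p and p = I_v for some nonzero finitely generated ideal I of D. -/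
open IVP Polynomial

namespace IVP

section TInvertible

variable {F : Type} [Field F] {D : Subring F}

theorem dinv_antitone {D I J : Set F} (h : I ⊆ J) : dinv D J ⊆ dinv D I :=
  fun _ hx y hy => hx y (h hy)

theorem dv_mono {D I J : Set F} (h : I ⊆ J) : dv D I ⊆ dv D J :=
  dinv_antitone (dinv_antitone h)

theorem subset_dv (D I : Set F) : I ⊆ dv D I :=
  fun y hy x hx => mul_comm x y ▸ hx y hy

theorem dinv_dv (D I : Set F) : dinv D (dv D I) = dinv D I :=
  (dinv_antitone (subset_dv D I)).antisymm (subset_dv D (dinv D I))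

theorem dv_dv (D I : Set F) : dv D (dv D I) = dv D I :=
  congrArg (dinv D) (dinv_dv D I)

theorem one_mem_dinv {I : Set F} (h : I ⊆ D) : (1 : F) ∈ dinv (D : Set F) I :=
  fun y hy => by simpa using h hy

theorem dv_subset {I : Set F} (h : I ⊆ D) : dv (D : Set F) I ⊆ D :=
  fun x hx => by simpa using hx 1 (one_mem_dinv h)

theorem dt_subset {I : Set F} (h : I ⊆ D) : dt (D : Set F) I ⊆ D := by
  rintro x ⟨T, hT, -, hx⟩
  exact dv_subset (hT.trans h) hx

theorem subset_dt {D I : Set F} (h : ∃ y ∈ I, y ≠ 0) : I ⊆ dt D I := by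
  classical
  obtain ⟨y, hy, hy0⟩ := h
  intro x hx
  refine ⟨{x, y}, ?_, ⟨y, by simp, hy0⟩, subset_dv _ _ (by simp)⟩
  intro z hz
  simp only [Finset.coe_insert, Finset.coe_singleton, Set.mem_insert_iff,
    Set.mem_singleton_iff] at hz
  rcases hz with rfl | rfl <;> assumption

theorem coe_mem_iset {p : Ideal D} {d : D} : (d : F) ∈ iset D (p : Set D) ↔ d ∈ p := by
  simp [iset]

theorem iset_subset (I : Set D) : iset D I ⊆ (D : Set F) := by
  rintro _ ⟨d, -, rfl⟩
  exact d.2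

theorem mul_coe_mem {p : Ideal D} {x : F} (hx : x ∈ dinv (D : Set F) (iset D (p : Set D)))
    {d : D} (hd : d ∈ p) : x * d ∈ D :=
  hx _ (coe_mem_iset.2 hd)

theorem setMul_dinv_subset (I : Set F) : setMul (dinv (D : Set F) I) I ⊆ D := by
  rintro _ ⟨x, hx, y, hy, rfl⟩
  exact hx y hy

theorem IsTIdeal.exists_ne_zero {p : Ideal D} (h : IsTIdeal (D : Set F) (iset D (p : Set D))) :
    ∃ y ∈ p, y ≠ 0 := by
  have h0 : ((0 : D) : F) ∈ dt (D : Set F) (iset D (p : Set D)) := by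
    rw [h]; exact coe_mem_iset.2 p.zero_mem
  obtain ⟨T, hT, ⟨y, hy, hy0⟩, -⟩ := h0
  obtain ⟨d, hd, rfl⟩ := hT hy
  exact ⟨d, hd, fun h => hy0 (by simp [h])⟩

theorem dv_subset_of_isTIdeal {I : Set F} {D : Set F} (h : IsTIdeal D I) {T : Finset F}
    (hT : (T : Set F) ⊆ I) (hT0 : ∃ y ∈ T, y ≠ 0) : dv D T ⊆ I :=
  fun x hx => h ▸ (⟨T, hT, hT0, hx⟩ : x ∈ dt D I)

/-- For a t-ideal `p` and `a ∉ p`, the ideal `(p : a)` is a t-ideal. -/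
theorem isTIdeal_colon {p q : Ideal D} (h : IsTIdeal (D : Set F) (iset D (p : Set D)))
    {a : D} (ha : a ∉ p) (hq : ∀ d, d ∈ q ↔ a * d ∈ p) :
    IsTIdeal (D : Set F) (iset D (q : Set D)) := by
  classical
  have ha0 : (a : F) ≠ 0 := by
    intro h0
    exact ha ((Subtype.ext h0 : a = 0) ▸ p.zero_mem)
  refine Set.Subset.antisymm ?_ (subset_dt ?_)
  · rintro x ⟨T, hT, ⟨y, hy, hy0⟩, hx⟩
    have hxD : x ∈ D := dv_subset (hT.trans (iset_subset _)) hx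
    suffices ((⟨x, hxD⟩ : D) : F) ∈ iset D (q : Set D) from this
    rw [coe_mem_iset, hq, ← coe_mem_iset]
    refine dv_subset_of_isTIdeal h (T := T.image ((a : F) * ·)) ?_
      ⟨a * y, Finset.mem_image_of_mem _ hy, mul_ne_zero ha0 hy0⟩ ?_
    · intro z hz
      obtain ⟨t, ht, rfl⟩ := Finset.mem_image.1 (Finset.mem_coe.1 hz)
      obtain ⟨d, hd, rfl⟩ := hT ht
      exact coe_mem_iset.2 ((hq d).1 hd)
    · intro z hz
      have hza : z * a ∈ dinv (D : Set F) T := fun t ht => by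
        rw [mul_assoc]
        exact hz _ (Finset.mem_coe.2 (Finset.mem_image_of_mem _ ht))
      have := hx _ hza
      rwa [show x * (z * a) = ((a * ⟨x, hxD⟩ : D) : F) * z by push_cast; ring] at this
  · obtain ⟨y, hy, hy0⟩ := h.exists_ne_zero
    exact ⟨y, coe_mem_iset.2 ((hq y).2 (p.mul_mem_left a hy)), by simpa using hy0⟩

theorem IsTMax.isPrime {p : Ideal D} (h : IsTMax D p) : p.IsPrime := by
  refine ⟨h.1, fun {a b} hab => or_iff_not_imp_left.2 fun ha => ?_⟩
  let q : Ideal D := Submodule.comap (LinearMap.mulLeft D a) p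
  have hq : ∀ d, d ∈ q ↔ a * d ∈ p := fun d => Iff.rfl
  have hpq : p = q := h.2.2 q
    (fun htop => ha (by simpa using (hq 1).1 (htop ▸ Submodule.mem_top)))
    (isTIdeal_colon h.2.1 ha hq) (fun d hd => (hq d).2 (p.mul_mem_left a hd))
  rw [hpq]
  exact hab

/-- A t-invertible ideal is t-invertible through finitely many of its elements. -/
theorem TInv.exists_finset {p : Ideal D} (h : TInv D p) :
    ∃ Y : Finset D, (∀ y ∈ Y, y ∈ p) ∧ (∃ y ∈ Y, y ≠ 0) ∧
      ∀ z : F, (∀ x ∈ dinv (D : Set F) (iset D (p : Set D)), ∀ y ∈ Y, z * (x * (y : F)) ∈ D) →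
        z ∈ D := by
  classical
  have h1 : (1 : F) ∈ (D : Set F) := D.one_mem
  rw [← (h : _ = _)] at h1
  obtain ⟨T, hT, ⟨t, ht, ht0⟩, h1⟩ := h1
  have hT' : ∀ t : T, ∃ x ∈ dinv (D : Set F) (iset D (p : Set D)), ∃ y ∈ p, (t : F) = x * y := by
    rintro ⟨t, ht⟩
    obtain ⟨x, hx, _, ⟨y, hy, rfl⟩, hxy⟩ := hT ht
    exact ⟨x, hx, y, hy, hxy⟩
  choose x hx y hy hxy using hT'
  refine ⟨Finset.univ.image y, fun z hz => ?_, ⟨y ⟨t, ht⟩, by simp, ?_⟩, ?_⟩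
  · obtain ⟨t, -, rfl⟩ := Finset.mem_image.1 hz
    exact hy t
  · intro h0
    exact ht0 (by simpa [h0] using hxy ⟨t, ht⟩)
  · intro z hz
    have : z ∈ dinv (D : Set F) T := fun t ht => by
      have := hz _ (hx ⟨t, ht⟩) (y ⟨t, ht⟩) (by simp)
      rwa [← hxy] at this
    simpa using h1 z this

theorem TInv.exists_mul_not_mem {p : Ideal D} (h : TInv D p) (hp : p ≠ ⊤)
    (ht : IsTIdeal (D : Set F) (iset D (p : Set D))) :
    ∃ x ∈ dinv (D : Set F) (iset D (p : Set D)), ∃ y ∈ p, ∃ u, u ∉ p ∧ (u : F) = x * y := by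
  by_contra! hc
  have h1 : ((1 : D) : F) ∈ (D : Set F) := D.one_mem
  rw [← (h : _ = _)] at h1
  obtain ⟨T, hT, hT0, h1⟩ := h1
  refine hp (p.eq_top_iff_one.2 (coe_mem_iset.1 (dv_subset_of_isTIdeal ht ?_ hT0 h1)))
  intro t htT
  obtain ⟨x, hx, _, ⟨y, hy, rfl⟩, rfl⟩ := hT htT
  have hxy := mul_coe_mem hx hy
  by_contra hn
  exact hc x hx y hy ⟨_, hxy⟩ (fun hm => hn (coe_mem_iset.2 hm)) rfl

theorem TInv.isTMax {p : Ideal D} (h : TInv D p) (hp : p.IsPrime)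
    (ht : IsTIdeal (D : Set F) (iset D (p : Set D))) : IsTMax D p := by
  classical
  refine ⟨hp.ne_top, ht, fun q hq hqt hpq => hpq.antisymm fun c hc => ?_⟩
  by_contra hcp
  obtain ⟨Y, hY, ⟨y, hy, hy0⟩, hz⟩ := h.exists_finset
  refine hq (q.eq_top_iff_one.2 (coe_mem_iset.1
    (dv_subset_of_isTIdeal hqt (T := (insert c Y).image ((↑) : D → F)) ?_
      ⟨y, Finset.mem_image_of_mem _ (Finset.mem_insert_of_mem hy), by simpa using hy0⟩ ?_)))
  · intro z hz
    obtain ⟨d, hd, rfl⟩ := Finset.mem_image.1 (Finset.mem_coe.1 hz)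
    rcases Finset.mem_insert.1 hd with rfl | hd
    · exact coe_mem_iset.2 hc
    · exact coe_mem_iset.2 (hpq (hY d hd))
  · intro z hzT
    have hzc : z * c ∈ D := hzT _ (Finset.mem_coe.2
      (Finset.mem_image_of_mem _ (Finset.mem_insert_self c Y)))
    suffices z ∈ D by simpa using this
    refine hz z fun x hx y hy => ?_
    have hzy : z * y ∈ D := hzT _ (Finset.mem_coe.2
      (Finset.mem_image_of_mem _ (Finset.mem_insert_of_mem hy)))
    have hmem : c * ⟨z * y, hzy⟩ ∈ p := by
      rw [show c * ⟨z * y, hzy⟩ = ⟨z * c, hzc⟩ * y from Subtype.ext (by push_cast; ring)]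
      exact p.mul_mem_left _ (hY y hy)
    have := mul_coe_mem hx ((hp.mem_or_mem hmem).resolve_left hcp)
    rwa [show z * (x * y) = x * (z * y) by ring]

theorem TInv.exists_eq_conductor (hqf : IsQuotField D) {p : Ideal D} (h : TInv D p)
    (hp : p.IsPrime) (ht : IsTIdeal (D : Set F) (iset D (p : Set D))) :
    ∃ a b : D, a ≠ 0 ∧ (p : Set D) = Conductor D a b := by
  obtain ⟨x, hx, y, hy, u, hu, huxy⟩ := h.exists_mul_not_mem hp.ne_top ht
  obtain ⟨b, a, ha, hab⟩ := hqf x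
  have ha' : (a : F) ≠ 0 := by simpa using ha
  refine ⟨a, b, ha, Set.ext fun d => ⟨fun hd => ?_, ?_⟩⟩
  · refine ⟨⟨_, mul_coe_mem hx hd⟩, Subtype.ext ?_⟩
    push_cast
    rw [← hab]
    ring
  · rintro ⟨c, hc⟩
    have hc' : (d : F) * b = a * c := by exact_mod_cast congrArg ((↑) : D → F) hc
    have hdx : (d : F) * x = c := mul_left_cancel₀ ha' (by rw [← hc', ← hab]; ring)
    refine (hp.mem_or_mem (y := u) ?_).resolve_right hu
    rw [show d * u = c * y from Subtype.ext (by push_cast; rw [huxy, ← hdx]; ring)]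
    exact p.mul_mem_left c hy

theorem dinv_iset_span (S : Set D) :
    dinv (D : Set F) (iset D (Ideal.span S : Set D)) = dinv D (iset D S) := by
  refine (dinv_antitone (Set.image_mono Ideal.subset_span)).antisymm ?_
  rintro z hz _ ⟨d, hd, rfl⟩
  induction hd using Submodule.span_induction with
  | mem d hd => exact hz _ ⟨d, hd, rfl⟩
  | zero => simp
  | add a b _ _ iha ihb =>
    push_cast
    rw [mul_add]
    exact D.add_mem iha ihb
  | smul c a _ iha =>
    rw [smul_eq_mul, Subring.coe_mul, mul_left_comm]
    exact D.mul_mem c.2 iha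

theorem dv_iset_span (S : Set D) :
    dv (D : Set F) (iset D (Ideal.span S : Set D)) = dv D (iset D S) :=
  congrArg (dinv _) (dinv_iset_span S)

theorem TInv.exists_fg {p : Ideal D} (h : TInv D p)
    (ht : IsTIdeal (D : Set F) (iset D (p : Set D))) :
    ∃ I : Ideal D, I ≠ ⊥ ∧ I.FG ∧ iset D (p : Set D) = dv (D : Set F) (iset D (I : Set D)) := by
  classical
  obtain ⟨Y, hY, ⟨y, hy, hy0⟩, hz⟩ := h.exists_finset
  refine ⟨Ideal.span Y, fun hbot => hy0 ?_, ⟨Y, rfl⟩, ?_⟩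
  · have : y ∈ Ideal.span (Y : Set D) := Ideal.subset_span hy
    rwa [hbot, Ideal.mem_bot] at this
  rw [dv_iset_span]
  refine Set.Subset.antisymm ?_ ?_
  · rintro _ ⟨d, hd, rfl⟩ z hzY
    refine hz _ fun x hx y hy => ?_
    rw [show (d : F) * z * (x * y) = (x * d) * (z * y) by ring]
    exact D.mul_mem (mul_coe_mem hx hd) (hzY _ ⟨y, hy, rfl⟩)
  · rw [show iset D (Y : Set D) = ((Y.image ((↑) : D → F) : Finset F) : Set F) by
      simp [iset]]
    refine dv_subset_of_isTIdeal ht ?_ ⟨y, Finset.mem_image_of_mem _ hy, by simpa using hy0⟩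
    intro z hz
    obtain ⟨d, hd, rfl⟩ := Finset.mem_image.1 (Finset.mem_coe.1 hz)
    exact coe_mem_iset.2 (hY d hd)

theorem TInv.pLocPrincipal {p : Ideal D} (h : TInv D p) (hp : p.IsPrime)
    (ht : IsTIdeal (D : Set F) (iset D (p : Set D))) : PLocPrincipal D p := by
  obtain ⟨x, hx, y, hy, u, hu, huxy⟩ := h.exists_mul_not_mem hp.ne_top ht
  have hu0 : (u : F) ≠ 0 := fun h0 => hu ((Subtype.ext h0 : u = 0) ▸ p.zero_mem)
  refine ⟨y, Set.ext fun w => ⟨?_, ?_⟩⟩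
  · rintro ⟨d, hd, s, hs, hw⟩
    refine ⟨w * x / u, ⟨⟨_, mul_coe_mem hx hd⟩, s * u,
      fun hm => (hp.mem_or_mem hm).elim hs hu, ?_⟩, ?_⟩
    · push_cast
      rw [← hw]
      field_simp
    · rw [div_mul_eq_mul_div, mul_assoc, ← huxy, mul_div_cancel_right₀ _ hu0]
  · rintro ⟨d, ⟨a, s, hs, hd⟩, rfl⟩
    exact ⟨a * y, p.mul_mem_left a hy, s, hs, by push_cast; rw [← hd]; ring⟩

/-- Finitely many elements of `gD_p` are carried into `gD` by a common multiplier outside `p`. -/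
theorem exists_common_denom_s5 {p : Ideal D} (hp : p.IsPrime) {g : F} (Y : Finset D)
    (hY : ∀ y ∈ Y, ∃ d ∈ plocSet D p, (y : F) = d * g) :
    ∃ s : D, s ∉ p ∧ ∀ y ∈ Y, ∃ c : D, (s : F) * y = c * g := by
  classical
  induction Y using Finset.induction_on with
  | empty => exact ⟨1, fun h => hp.ne_top (p.eq_top_iff_one.2 h), by simp⟩
  | insert y Y _ ih =>
    obtain ⟨s, hs, hsY⟩ := ih fun z hz => hY z (Finset.mem_insert_of_mem hz)
    obtain ⟨d, ⟨a, t, ht, hd⟩, hy⟩ := hY y (Finset.mem_insert_self y Y)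
    refine ⟨s * t, fun hm => (hp.mem_or_mem hm).elim hs ht, fun z hz => ?_⟩
    rcases Finset.mem_insert.1 hz with rfl | hz
    · exact ⟨s * a, by push_cast; rw [hy, ← hd]; ring⟩
    · obtain ⟨c, hc⟩ := hsY z hz
      refine ⟨t * c, ?_⟩
      push_cast
      rw [mul_assoc (t : F), ← hc]
      ring

/-- The ideal `S_v ∩ D` of `D`; it is `S_v` when `S ⊆ D`. -/
def dvIdeal (D : Subring F) (S : Set F) : Ideal D where
  carrier := {d | (d : F) ∈ dv (D : Set F) S}
  zero_mem' := fun z _ => by simp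
  add_mem' := fun ha hb z hz => by
    push_cast
    rw [add_mul]
    exact D.add_mem (ha z hz) (hb z hz)
  smul_mem' := fun c a ha z hz => by
    rw [smul_eq_mul, Subring.coe_mul, mul_assoc]
    exact D.mul_mem c.2 (ha z hz)

theorem iset_dvIdeal (S : Set F) (hS : S ⊆ (D : Set F)) :
    iset D (dvIdeal D S : Set D) = dv (D : Set F) S := by
  ext x
  refine ⟨?_, fun hx => ⟨⟨x, dv_subset hS hx⟩, hx, rfl⟩⟩
  rintro ⟨d, hd, rfl⟩
  exact hd

theorem isTIdeal_dv {D S : Set F} (h : ∃ y ∈ dv D S, y ≠ 0) : IsTIdeal D (dv D S) := by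
  refine Set.Subset.antisymm ?_ (subset_dt h)
  rintro x ⟨T, hT, -, hx⟩
  exact dv_dv D S ▸ dv_mono hT hx

/-- If `p` is t-maximal and `p = I_v` with `I` generated by a finite set `Y`, then adjoining to
`Y` any element outside `p` yields a set whose v-closure is `D`. -/
theorem IsTMax.one_mem_dv_insert {p : Ideal D} (h : IsTMax D p) {Y : Set D}
    (hY : iset D (p : Set D) = dv (D : Set F) (iset D Y)) {u : D} (hu : u ∉ p) :
    (1 : F) ∈ dv (D : Set F) (iset D (insert u Y)) := by
  have hle : p ≤ dvIdeal D (iset D (insert u Y)) := fun d hd => by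
    have : (d : F) ∈ iset D (p : Set D) := coe_mem_iset.2 hd
    rw [hY] at this
    exact dv_mono (Set.image_mono (Set.subset_insert u Y)) this
  by_contra hn
  have hpJ : p = dvIdeal D (iset D (insert u Y)) := h.2.2 _ ?top ?tideal hle
  · refine hu ?_
    rw [hpJ]
    exact subset_dv _ _ ⟨u, Set.mem_insert u Y, rfl⟩
  · intro htop
    have : (1 : D) ∈ dvIdeal D (iset D (insert u Y)) := htop ▸ Submodule.mem_top
    exact hn this
  · rw [iset_dvIdeal _ (iset_subset _)]
    obtain ⟨y, hy, hy0⟩ := h.2.1.exists_ne_zero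
    exact isTIdeal_dv ⟨y, hle hy, by simpa using hy0⟩

theorem IsTMax.tInv {p : Ideal D} (h : IsTMax D p) (hloc : PLocPrincipal D p) {I : Ideal D}
    (hI : I.FG) (hpI : iset D (p : Set D) = dv (D : Set F) (iset D (I : Set D))) : TInv D p := by
  classical
  have hp := h.isPrime
  have h1p : (1 : D) ∉ p := fun h1 => h.1 (p.eq_top_iff_one.2 h1)
  obtain ⟨Y, rfl⟩ := hI
  obtain ⟨g, hg⟩ := hloc
  have hmem : ∀ y ∈ p, ∃ d ∈ plocSet D p, (y : F) = d * g := fun y hy => by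
    have : (y : F) ∈ plocIdl D p := ⟨y, hy, 1, h1p, by simp⟩
    rwa [hg] at this
  have hgp : g ∈ plocIdl D p := by
    rw [hg]
    exact ⟨1, ⟨1, 1, h1p, by simp⟩, by simp⟩
  obtain ⟨y, hy, t, ht, hgy⟩ := hgp
  obtain ⟨y₀, hy₀, hy₀0⟩ := h.2.1.exists_ne_zero
  have hg0 : g ≠ 0 := by
    rintro rfl
    obtain ⟨d, -, hd⟩ := hmem y₀ hy₀
    exact hy₀0 (Subtype.ext (by simpa using hd))
  have hYp : ∀ y ∈ Y, y ∈ p := fun y hy => by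
    rw [← coe_mem_iset, hpI]
    exact subset_dv _ _ ⟨y, Ideal.subset_span hy, rfl⟩
  obtain ⟨s, hs, hsY⟩ := exists_common_denom_s5 hp Y fun y hy => hmem y (hYp y hy)
  have hx : (s : F) / g ∈ dinv (D : Set F) (iset D (p : Set D)) := by
    rw [hpI, dinv_dv, dinv_iset_span]
    rintro _ ⟨y, hy, rfl⟩
    obtain ⟨c, hc⟩ := hsY y hy
    rw [div_mul_eq_mul_div, hc, mul_div_cancel_right₀ _ hg0]
    exact c.2
  have hu : s * t ∉ p := fun hm => (hp.mem_or_mem hm).elim hs ht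
  have hu0 : ((s * t : D) : F) ≠ 0 := fun h0 => hu ((Subtype.ext h0 : s * t = 0) ▸ p.zero_mem)
  have h1 := h.one_mem_dv_insert (hpI.trans (dv_iset_span _)) hu
  refine (dt_subset (setMul_dinv_subset _)).antisymm fun d hd => ?_
  refine ⟨(insert (s * t) Y).image ((↑) : D → F), ?_,
    ⟨_, Finset.mem_image_of_mem _ (Finset.mem_insert_self _ _), hu0⟩, ?_⟩
  · intro z hz
    obtain ⟨e, he, rfl⟩ := Finset.mem_image.1 (Finset.mem_coe.1 hz)
    rcases Finset.mem_insert.1 he with rfl | he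
    · refine ⟨_, hx, y, coe_mem_iset.2 hy, ?_⟩
      rw [← hgy]
      push_cast
      field_simp
    · exact ⟨1, one_mem_dinv (iset_subset _), e, coe_mem_iset.2 (hYp e he), by simp⟩
  · intro z hz
    have : (1 : F) * z ∈ (D : Set F) := h1 z (by simpa only [iset, Finset.coe_image, Finset.coe_insert] using hz)
    rw [one_mul] at this
    exact D.mul_mem hd this

end TInvertible

end IVP

/-- (i) Every t-invertible t-prime of `D` is t-maximal and lies in
`Ass(K/D)`, i.e. equals a conductor ideal `(aD :_D bD)`.  (ii) A t-maximal ideal `p`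
is t-invertible iff `pD_p` is principal and `p = I_v` for some nonzero finitely
generated ideal `I`. -/
theorem stmt_5 (F : Type) [Field F] (D : Subring F)
    (hqf : IsQuotField D) (hne : (↑D : Set F) ≠ Set.univ) :
    (∀ p : Ideal ↥D, p.IsPrime → IsTIdeal ↑D (iset D ↑p) → TInv D p →
        IsTMax D p ∧ ∃ a b : ↥D, a ≠ 0 ∧ (↑p : Set ↥D) = Conductor D a b) ∧
      ∀ p : Ideal ↥D, IsTMax D p →
        (TInv D p ↔ PLocPrincipal D p ∧
          ∃ I : Ideal ↥D, I ≠ ⊥ ∧ I.FG ∧ iset D ↑p = dv ↑D (iset D ↑I)) := by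
  exact ⟨fun p hp ht h => ⟨h.isTMax hp ht, h.exists_eq_conductor hqf hp ht⟩,
    fun p hp => ⟨fun h => ⟨h.pLocPrincipal hp.isPrime hp.2.1, h.exists_fg hp.2.1⟩,
      fun ⟨hloc, _, _, hI, hpI⟩ => hp.tInv hloc hI hpI⟩⟩
end
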